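/- arXiv:1903.07906 — 6 statements merged into one kernel-verified Lean document; each statement's English description precedes it below -/
import Mathlib

section
/- Let A be an n×n nonnegative real matrix of block form A = [[A₁, B], [C, 0]], where A₁ is an l×l irreducible matrix with 1 ≤ l < n and the lower-right block is the (n-l)×(n-l) zero matrix. If A has no zero row and no zero column, then A is irreducible. -/
/-- A nonnegative square real matrix `M` is irreducible if there is no nonempty
proper subset `S` of the index set with `M i j = 0` for every `i ∈ S`, `j ∉ S`. -/
def Matrix.Irred {ι : Type*} (M : Matrix ι ι ℝ) : Prop :=
  ¬ ∃ S : Set ι, S.Nonempty ∧ S ≠ Set.univ ∧ ∀ i ∈ S, ∀ j ∉ S, M i j = 0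

/-- (Shao.)  Let `A = [[A₁, B], [C, 0]]` be an `n×n` nonnegative matrix
(`n = l + m`, `1 ≤ l`, `1 ≤ m`, so `1 ≤ l < n`) where `A₁` is an `l×l`
irreducible matrix and the lower-right block is the `m×m` zero matrix.
If `A` has no zero row and no zero column, then `A` is irreducible. -/
theorem shao_irreducible (l m : ℕ) (hl : 1 ≤ l) (hm : 1 ≤ m)
    (A₁ : Matrix (Fin l) (Fin l) ℝ) (B : Matrix (Fin l) (Fin m) ℝ)
    (C : Matrix (Fin m) (Fin l) ℝ)
    (hA0 : ∀ i j, 0 ≤ Matrix.fromBlocks A₁ B C (0 : Matrix (Fin m) (Fin m) ℝ) i j)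
    (hA₁ : A₁.Irred)
    (hrow : ∀ i, ∃ j, Matrix.fromBlocks A₁ B C (0 : Matrix (Fin m) (Fin m) ℝ) i j ≠ 0)
    (hcol : ∀ j, ∃ i, Matrix.fromBlocks A₁ B C (0 : Matrix (Fin m) (Fin m) ℝ) i j ≠ 0) :
    (Matrix.fromBlocks A₁ B C (0 : Matrix (Fin m) (Fin m) ℝ)).Irred := by
  rintro ⟨S, ⟨x, hx⟩, hS, h⟩
  have hinl : Sum.inl ⁻¹' S = (∅ : Set (Fin l)) ∨ Sum.inl ⁻¹' S = (Set.univ : Set (Fin l)) := by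
    by_contra! hT
    exact hA₁ ⟨Sum.inl ⁻¹' S, hT.1, hT.2,
      fun i hi j hj => h (Sum.inl i) hi (Sum.inl j) hj⟩
  rcases hinl with hT | hT
  · have hnot : ∀ i, Sum.inl i ∉ S := fun i hi => (Set.ext_iff.mp hT i).mp hi
    rcases x with i | k
    · exact hnot i hx
    · obtain ⟨j | j, hj⟩ := hrow (Sum.inr k)
      · exact hj (h _ hx _ (hnot j))
      · exact hj rfl
  · have hmem : ∀ i, Sum.inl i ∈ S := fun i => (Set.ext_iff.mp hT i).mpr trivial
    obtain ⟨y, hy⟩ := (Set.ne_univ_iff_exists_notMem S).mp hS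
    rcases y with i | k
    · exact hy (hmem i)
    · obtain ⟨i | i, hi⟩ := hcol (Sum.inr k)
      · exact hi (h _ (hmem i) _ hy)
      · exact hi rfl
end

section
/- Let n ≥ 1, let Dᵃ, Dᵇ, Dᶜ, Dᵈ be n×n diagonal matrices with strictly positive diagonal entries satisfying Dᵃ + Dᵇ = I and Dᶜ + Dᵈ = I, let 𝔄 be a nonnegative, irreducible, row-stochastic n×n matrix, and let σ ∈ (0,1). Then the 2n×2n matrix Ω = [[Dᵃ, Dᵇ], [Dᶜ, Dᵈ]] · [[I_n, 0], [σ·𝔄, (1-σ)·I_n]] = [[Dᵃ + σ·Dᵇ·𝔄, (1-σ)·Dᵇ], [Dᶜ + σ·Dᵈ·𝔄, (1-σ)·Dᵈ]] is irreducible and row-stochastic. -/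
open Matrix

/-- Let `n ≥ 1`, let `Da, Db, Dc, Dd` be `n×n` diagonal matrices with strictly
positive diagonal entries satisfying `Da + Db = I` and `Dc + Dd = I`, let `𝔄` be
a nonnegative, irreducible, row-stochastic `n×n` matrix and let `σ ∈ (0,1)`.
Then the `2n×2n` matrix
`Ω = [[Da, Db], [Dc, Dd]] · [[Iₙ, 0], [σ·𝔄, (1-σ)·Iₙ]]`
equals `[[Da + σ·Db·𝔄, (1-σ)·Db], [Dc + σ·Dd·𝔄, (1-σ)·Dd]]` and is irreducible
and row-stochastic. -/
theorem Omega_irreducible_rowStochastic (n : ℕ) (hn : 1 ≤ n)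
    (Da Db Dc Dd : Matrix (Fin n) (Fin n) ℝ)
    (hDa : Da.IsDiag) (hDb : Db.IsDiag) (hDc : Dc.IsDiag) (hDd : Dd.IsDiag)
    (hDaPos : ∀ i, 0 < Da i i) (hDbPos : ∀ i, 0 < Db i i)
    (hDcPos : ∀ i, 0 < Dc i i) (hDdPos : ∀ i, 0 < Dd i i)
    (hab : Da + Db = 1) (hcd : Dc + Dd = 1)
    (𝔄 : Matrix (Fin n) (Fin n) ℝ)
    (h𝔄0 : ∀ i j, 0 ≤ 𝔄 i j) (h𝔄irr : 𝔄.Irred) (h𝔄1 : ∀ i, ∑ j, 𝔄 i j = 1)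
    (σ : ℝ) (hσ : σ ∈ Set.Ioo (0 : ℝ) 1)
    (Ω : Matrix (Fin n ⊕ Fin n) (Fin n ⊕ Fin n) ℝ)
    (hΩ : Ω = Matrix.fromBlocks Da Db Dc Dd *
      Matrix.fromBlocks (1 : Matrix (Fin n) (Fin n) ℝ) 0
        (σ • 𝔄) ((1 - σ) • (1 : Matrix (Fin n) (Fin n) ℝ))) :
    Ω = Matrix.fromBlocks (Da + σ • (Db * 𝔄)) ((1 - σ) • Db)
        (Dc + σ • (Dd * 𝔄)) ((1 - σ) • Dd) ∧
      Ω.Irred ∧ (∀ i j, 0 ≤ Ω i j) ∧ (∀ i, ∑ j, Ω i j = 1) := by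
  have hσ0 : 0 < σ := hσ.1
  have hσ1 : 0 < 1 - σ := sub_pos.2 hσ.2
  have hblock : Ω = Matrix.fromBlocks (Da + σ • (Db * 𝔄)) ((1 - σ) • Db)
      (Dc + σ • (Dd * 𝔄)) ((1 - σ) • Dd) := by
    rw [hΩ, Matrix.fromBlocks_multiply]
    simp
  refine ⟨hblock, ?_⟩
  clear hΩ
  obtain ⟨a, rfl⟩ : ∃ a, Da = diagonal a := ⟨_, hDa.diagonal_diag.symm⟩
  obtain ⟨b, rfl⟩ : ∃ b, Db = diagonal b := ⟨_, hDb.diagonal_diag.symm⟩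
  obtain ⟨c, rfl⟩ : ∃ c, Dc = diagonal c := ⟨_, hDc.diagonal_diag.symm⟩
  obtain ⟨d, rfl⟩ : ∃ d, Dd = diagonal d := ⟨_, hDd.diagonal_diag.symm⟩
  simp only [diagonal_apply_eq] at hDaPos hDbPos hDcPos hDdPos
  have hab' (i) : a i + b i = 1 := by simpa using congr_fun₂ hab i i
  have hcd' (i) : c i + d i = 1 := by simpa using congr_fun₂ hcd i i
  have h₁₁ (i j) : Ω (.inl i) (.inl j) = diagonal a i j + σ * (b i * 𝔄 i j) := by
    simp [hblock]
  have h₁₂ (i j) : Ω (.inl i) (.inr j) = (1 - σ) * diagonal b i j := by simp [hblock]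
  have h₂₁ (i j) : Ω (.inr i) (.inl j) = diagonal c i j + σ * (d i * 𝔄 i j) := by
    simp [hblock]
  have h₂₂ (i j) : Ω (.inr i) (.inr j) = (1 - σ) * diagonal d i j := by simp [hblock]
  have hdiag {v : Fin n → ℝ} (hv : ∀ i, 0 < v i) (i j) : 0 ≤ diagonal v i j := by
    rw [diagonal_apply]
    split_ifs
    exacts [(hv i).le, le_rfl]
  have hterm {v : Fin n → ℝ} (hv : ∀ i, 0 < v i) (i j) : 0 ≤ σ * (v i * 𝔄 i j) :=
    mul_nonneg hσ0.le (mul_nonneg (hv i).le (h𝔄0 i j))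
  refine ⟨?_, ?_, ?_⟩
  · rintro ⟨S, ⟨x, hx⟩, hS, hzero⟩
    have hlr (i) (hi : Sum.inl i ∈ S) : Sum.inr i ∈ S := by
      by_contra hi'
      have h := hzero _ hi _ hi'
      rw [h₁₂, diagonal_apply_eq] at h
      exact (mul_pos hσ1 (hDbPos i)).ne' h
    have hrl (i) (hi : Sum.inr i ∈ S) : Sum.inl i ∈ S := by
      by_contra hi'
      have h := hzero _ hi _ hi'
      rw [h₂₁, diagonal_apply_eq] at h
      exact (add_pos_of_pos_of_nonneg (hDcPos i) (hterm hDdPos i i)).ne' h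
    refine h𝔄irr ⟨Sum.inl ⁻¹' S, ?_, fun hT => hS ?_, fun i hi j hj => ?_⟩
    · rcases x with i | i
      exacts [⟨i, hx⟩, ⟨i, hrl i hx⟩]
    · have hl (i) : Sum.inl i ∈ S := Set.eq_univ_iff_forall.1 hT i
      rw [Set.eq_univ_iff_forall]
      rintro (i | i)
      exacts [hl i, hlr i (hl i)]
    · have hij : i ≠ j := fun h => hj (h ▸ hi)
      have h := hzero _ hi _ hj
      rw [h₁₁, diagonal_apply_ne _ hij, zero_add] at h
      simpa [hσ0.ne', (hDbPos i).ne'] using h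
  · rintro (i | i) (j | j)
    · exact h₁₁ i j ▸ add_nonneg (hdiag hDaPos i j) (hterm hDbPos i j)
    · exact h₁₂ i j ▸ mul_nonneg hσ1.le (hdiag hDbPos i j)
    · exact h₂₁ i j ▸ add_nonneg (hdiag hDcPos i j) (hterm hDdPos i j)
    · exact h₂₂ i j ▸ mul_nonneg hσ1.le (hdiag hDdPos i j)
  · rintro (i | i)
    · simp only [Fintype.sum_sum_type, h₁₁, h₁₂, Finset.sum_add_distrib, ← Finset.mul_sum, h𝔄1,
        diagonal_apply, Finset.sum_ite_eq, Finset.mem_univ, if_true]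
      linear_combination hab' i
    · simp only [Fintype.sum_sum_type, h₂₁, h₂₂, Finset.sum_add_distrib, ← Finset.mul_sum, h𝔄1,
        diagonal_apply, Finset.sum_ite_eq, Finset.mem_univ, if_true]
      linear_combination hcd' i
end

section
/- Let n ≥ 1, let Dᵃ, Dᵇ, Dᶜ, Dᵈ be n×n diagonal matrices with strictly positive diagonal entries satisfying Dᵃ + Dᵇ = I and Dᶜ + Dᵈ = I, let 𝔄 be a nonnegative, irreducible, row-stochastic n×n matrix, and let σ ∈ (0,1). Then the 2n×2n matrix Ω = [[Dᵃ + σ·Dᵇ·𝔄, (1-σ)·Dᵇ], [Dᶜ + σ·Dᵈ·𝔄, (1-σ)·Dᵈ]] is primitive, i.e. there exists h ≥ 1 such that every entry of Ω^h is strictly positive. -/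
open Matrix

namespace Matrix

theorem pow_succ_apply_pos {ι : Type*} [Fintype ι] [DecidableEq ι] {M : Matrix ι ι ℝ}
    (hM : ∀ i j, 0 ≤ M i j) {k : ℕ} {i j l : ι} (hij : 0 < (M ^ k) i j) (hjl : 0 < M j l) :
    0 < (M ^ (k + 1)) i l := by
  rw [pow_succ, mul_apply]
  exact Finset.sum_pos' (fun m _ => mul_nonneg (pow_apply_nonneg hM k i m) (hM m l))
    ⟨j, Finset.mem_univ j, mul_pos hij hjl⟩

theorem pow_apply_pos_of_le {ι : Type*} [Fintype ι] [DecidableEq ι] {M : Matrix ι ι ℝ}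
    (hM : ∀ i j, 0 ≤ M i j) (hdiag : ∀ i, 0 < M i i) {k m : ℕ} (hkm : k ≤ m) {i j : ι}
    (hij : 0 < (M ^ k) i j) : 0 < (M ^ m) i j := by
  induction m, hkm using Nat.le_induction with
  | base => exact hij
  | succ m _ ih => exact pow_succ_apply_pos hM ih (hdiag j)

theorem Irred.exists_pow_apply_pos {ι : Type*} [Fintype ι] [DecidableEq ι] {M : Matrix ι ι ℝ}
    (hirr : M.Irred) (hM : ∀ i j, 0 ≤ M i j) (i j : ι) : ∃ k : ℕ, 0 < (M ^ k) i j := by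
  by_contra hj
  refine hirr ⟨{l | ∃ k : ℕ, 0 < (M ^ k) i l}, ⟨i, 0, by simp⟩,
    fun h => hj (Set.eq_univ_iff_forall.1 h j), ?_⟩
  rintro l ⟨k, hk⟩ m hm
  by_contra hlm
  exact hm ⟨k + 1, pow_succ_apply_pos hM hk ((hM l m).lt_of_ne' hlm)⟩

/-- A nonnegative irreducible matrix with positive diagonal is primitive. -/
theorem Irred.exists_forall_pow_apply_pos {ι : Type*} [Fintype ι] [DecidableEq ι]
    {M : Matrix ι ι ℝ} (hirr : M.Irred) (hM : ∀ i j, 0 ≤ M i j) (hdiag : ∀ i, 0 < M i i) :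
    ∃ h : ℕ, 1 ≤ h ∧ ∀ i j, 0 < (M ^ h) i j := by
  choose k hk using hirr.exists_pow_apply_pos hM
  refine ⟨1 + ∑ i, ∑ j, k i j, Nat.le_add_right _ _, fun i j => ?_⟩
  refine pow_apply_pos_of_le hM hdiag ?_ (hk i j)
  calc k i j ≤ ∑ j, k i j := Finset.single_le_sum (f := k i) (by simp) (Finset.mem_univ j)
    _ ≤ ∑ i, ∑ j, k i j :=
      Finset.single_le_sum (f := fun i => ∑ j, k i j) (by simp) (Finset.mem_univ i)
    _ ≤ _ := Nat.le_add_left _ _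

theorem IsDiag.mul_apply {ι : Type*} [Fintype ι] [DecidableEq ι] {D : Matrix ι ι ℝ}
    (hD : D.IsDiag) (M : Matrix ι ι ℝ) (i j : ι) : (D * M) i j = D i i * M i j := by
  conv_lhs => rw [← hD.diagonal_diag, diagonal_mul, diag_apply]

theorem IsDiag.apply_nonneg {ι : Type*} {D : Matrix ι ι ℝ} (hD : D.IsDiag)
    (hpos : ∀ i, 0 < D i i) (i j : ι) : 0 ≤ D i j := by
  obtain rfl | hij := eq_or_ne i j
  · exact (hpos i).le
  · exact (hD hij).ge

/-- A nonnegative block matrix whose off-diagonal blocks have positive diagonals is irreducible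
as soon as the support of its upper left block contains that of an irreducible matrix. -/
theorem Irred.fromBlocks {ι : Type*} {M P Q R S : Matrix ι ι ℝ} (hirr : M.Irred)
    (hP : ∀ i j, P i j = 0 → M i j = 0) (hQ : ∀ i, 0 < Q i i) (hR : ∀ i, 0 < R i i) :
    (fromBlocks P Q R S).Irred := by
  rintro ⟨T, hne, huniv, hT⟩
  have hlr (i : ι) : Sum.inl i ∈ T ↔ Sum.inr i ∈ T := by
    constructor <;> intro hi <;> by_contra hj
    · exact (hQ i).ne' (hT _ hi _ hj)
    · exact (hR i).ne' (hT _ hi _ hj)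
  refine hirr ⟨{i | Sum.inl i ∈ T}, ?_, fun h => huniv ?_,
    fun i hi j hj => hP i j (hT _ hi _ hj)⟩
  · obtain ⟨i | i, hi⟩ := hne
    · exact ⟨i, hi⟩
    · exact ⟨i, (hlr i).2 hi⟩
  · have hl (i : ι) : Sum.inl i ∈ T := Set.eq_univ_iff_forall.1 h i
    ext (i | i)
    · simp [hl i]
    · simp [(hlr i).1 (hl i)]

end Matrix

/-- Let `n ≥ 1`, let `Da, Db, Dc, Dd` be `n×n` diagonal matrices with strictly
positive diagonal entries satisfying `Da + Db = I` and `Dc + Dd = I`, let `𝔄` be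
a nonnegative, irreducible, row-stochastic `n×n` matrix and let `σ ∈ (0,1)`.
Then the `2n×2n` matrix
`Ω = [[Da + σ·Db·𝔄, (1-σ)·Db], [Dc + σ·Dd·𝔄, (1-σ)·Dd]]`
is primitive: there exists `h ≥ 1` such that every entry of `Ω^h` is strictly
positive. -/
theorem Omega_primitive (n : ℕ) (hn : 1 ≤ n)
    (Da Db Dc Dd : Matrix (Fin n) (Fin n) ℝ)
    (hDa : Da.IsDiag) (hDb : Db.IsDiag) (hDc : Dc.IsDiag) (hDd : Dd.IsDiag)
    (hDaPos : ∀ i, 0 < Da i i) (hDbPos : ∀ i, 0 < Db i i)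
    (hDcPos : ∀ i, 0 < Dc i i) (hDdPos : ∀ i, 0 < Dd i i)
    (hab : Da + Db = 1) (hcd : Dc + Dd = 1)
    (𝔄 : Matrix (Fin n) (Fin n) ℝ)
    (h𝔄0 : ∀ i j, 0 ≤ 𝔄 i j) (h𝔄irr : 𝔄.Irred) (h𝔄1 : ∀ i, ∑ j, 𝔄 i j = 1)
    (σ : ℝ) (hσ : σ ∈ Set.Ioo (0 : ℝ) 1) :
    ∃ h : ℕ, 1 ≤ h ∧ ∀ i j, 0 <
      ((Matrix.fromBlocks (Da + σ • (Db * 𝔄)) ((1 - σ) • Db)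
        (Dc + σ • (Dd * 𝔄)) ((1 - σ) • Dd)) ^ h) i j := by
  obtain ⟨hσ0, hσ1⟩ := hσ
  have h1σ : 0 < 1 - σ := sub_pos.2 hσ1
  have hmul {D : Matrix (Fin n) (Fin n) ℝ} (hD : D.IsDiag) (hpos : ∀ i, 0 < D i i) (i j) :
      0 ≤ σ * (D * 𝔄) i j := by
    rw [hD.mul_apply]
    exact mul_nonneg hσ0.le (mul_nonneg (hpos i).le (h𝔄0 i j))
  refine Irred.exists_forall_pow_apply_pos (h𝔄irr.fromBlocks ?_ ?_ ?_) ?_ ?_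
  · intro i j hij
    have hDa0 := hDa.apply_nonneg hDaPos i j
    have hDb0 := hmul hDb hDbPos i j
    rw [Matrix.add_apply, Matrix.smul_apply, smul_eq_mul] at hij
    have h0 : σ * (Db * 𝔄) i j = 0 := by linarith
    rw [hDb.mul_apply] at h0
    simpa [hσ0.ne', (hDbPos i).ne'] using h0
  · exact fun i => mul_pos h1σ (hDbPos i)
  · exact fun i => add_pos_of_pos_of_nonneg (hDcPos i) (hmul hDd hDdPos i i)
  · rintro (i | i) (j | j)
    · exact add_nonneg (hDa.apply_nonneg hDaPos i j) (hmul hDb hDbPos i j)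
    · exact mul_nonneg h1σ.le (hDb.apply_nonneg hDbPos i j)
    · exact add_nonneg (hDc.apply_nonneg hDcPos i j) (hmul hDd hDdPos i j)
    · exact mul_nonneg h1σ.le (hDd.apply_nonneg hDdPos i j)
  · rintro (i | i)
    · exact add_pos_of_pos_of_nonneg (hDaPos i) (hmul hDb hDbPos i i)
    · exact mul_pos h1σ (hDdPos i)
end

section
/- Let m ≥ 1, let ε > 0, and let (Ω_k)_{k ∈ ℕ} be a sequence of m×m row-stochastic real matrices each of whose entries is at least ε. Then the backward products P_k = Ω_{k-1}·Ω_{k-2}·…·Ω_1·Ω_0 converge entrywise, as k → ∞, to a matrix of the form 𝟙·vᵀ, where 𝟙 is the all-ones column vector of length m and v is a nonnegative vector with Σ_{i=1}^m v_i = 1; equivalently, every column of the limit is constant and the limit is rank-one row-stochastic. -/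
open Filter Topology

/-- A weighted average with all weights at least `ε` stays `ε`-away, relative to the spread,
from the maximum. -/
theorem weighted_sum_le_iSup_iInf {ι : Type*} [Fintype ι] [Nonempty ι] {ε : ℝ} {w : ι → ℝ}
    (hε : 0 ≤ ε) (hw : ∀ j, ε ≤ w j) (hsum : ∑ j, w j = 1) (x : ι → ℝ) :
    ∑ j, w j * x j ≤ (⨆ i, x i) - ε * ((⨆ i, x i) - ⨅ i, x i) := by
  obtain ⟨j₀, hj₀⟩ := exists_eq_ciInf_of_finite (f := x)
  have hle : ∀ j, x j ≤ ⨆ i, x i := fun j => le_ciSup (Set.finite_range x).bddAbove j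
  have hsingle : w j₀ * ((⨆ i, x i) - x j₀) ≤ ∑ j, w j * ((⨆ i, x i) - x j) :=
    Finset.single_le_sum (f := fun j => w j * ((⨆ i, x i) - x j))
      (fun j _ => mul_nonneg (hε.trans (hw j)) (sub_nonneg.2 (hle j))) (Finset.mem_univ j₀)
  have hexpand : ∑ j, w j * ((⨆ i, x i) - x j) = (⨆ i, x i) - ∑ j, w j * x j := by
    simp only [mul_sub, Finset.sum_sub_distrib, ← Finset.sum_mul, hsum, one_mul]
  have hmul := mul_le_mul_of_nonneg_right (hw j₀) (sub_nonneg.2 (hle j₀))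
  rw [← hj₀]
  linarith

theorem iInf_le_weighted_sum {ι : Type*} [Fintype ι] {w : ι → ℝ}
    (hw : ∀ j, 0 ≤ w j) (hsum : ∑ j, w j = 1) (x : ι → ℝ) :
    ⨅ i, x i ≤ ∑ j, w j * x j := by
  calc ⨅ i, x i = ∑ j, w j * ⨅ i, x i := by rw [← Finset.sum_mul, hsum, one_mul]
    _ ≤ ∑ j, w j * x j := Finset.sum_le_sum fun j _ =>
      mul_le_mul_of_nonneg_left (ciInf_le (Set.finite_range x).bddBelow j) (hw j)

/-- Iterated averaging with weights uniformly bounded below reaches consensus. -/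
theorem exists_tendsto_of_averaging {ι : Type*} [Fintype ι] [Nonempty ι] {ε : ℝ} (hε : 0 < ε)
    {Ω : ℕ → Matrix ι ι ℝ} (hpos : ∀ k i j, ε ≤ Ω k i j) (hrow : ∀ k i, ∑ j, Ω k i j = 1)
    {x : ℕ → ι → ℝ} (hx : ∀ k i, x (k + 1) i = ∑ j, Ω k i j * x k j) :
    ∃ c, ∀ i, Tendsto (fun k => x k i) atTop (𝓝 c) := by
  have hle : ∀ k i, x k i ≤ ⨆ i, x k i := fun k i => le_ciSup (Set.finite_range _).bddAbove i
  have hge : ∀ k i, ⨅ i, x k i ≤ x k i := fun k i => ciInf_le (Set.finite_range _).bddBelow i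
  have hgap : ∀ k, ⨅ i, x k i ≤ ⨆ i, x k i := fun k =>
    (hge k (Classical.arbitrary ι)).trans (hle k _)
  have hsup : ∀ k, ⨆ i, x (k + 1) i ≤ (⨆ i, x k i) - ε * ((⨆ i, x k i) - ⨅ i, x k i) :=
    fun k => ciSup_le fun i => by
      rw [hx]
      exact weighted_sum_le_iSup_iInf hε.le (hpos k i) (hrow k i) (x k)
  have hinf : Monotone fun k => ⨅ i, x k i := monotone_nat_of_le_succ fun k =>
    le_ciInf fun i => by
      rw [hx]
      exact iInf_le_weighted_sum (fun j => hε.le.trans (hpos k i j)) (hrow k i) (x k)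
  have hanti : Antitone fun k => ⨆ i, x k i := antitone_nat_of_succ_le fun k => by
    linarith [hsup k, mul_nonneg hε.le (sub_nonneg.2 (hgap k))]
  have hε1 : ε ≤ 1 := by
    let i := Classical.arbitrary ι
    calc ε ≤ Ω 0 i i := hpos 0 i i
      _ ≤ ∑ j, Ω 0 i j := Finset.single_le_sum (f := fun j => Ω 0 i j)
        (fun j _ => hε.le.trans (hpos 0 i j)) (Finset.mem_univ i)
      _ = 1 := hrow 0 i
  have hgeom : ∀ k, (⨆ i, x k i) - ⨅ i, x k i ≤
      (1 - ε) ^ k * ((⨆ i, x 0 i) - ⨅ i, x 0 i) := by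
    intro k
    induction k with
    | zero => simp
    | succ k ih =>
      have hmul := mul_le_mul_of_nonneg_left ih (sub_nonneg.2 hε1)
      have hmono := hinf k.le_succ
      rw [pow_succ', mul_assoc]
      simp only [Nat.succ_eq_add_one] at hmono
      linarith [hsup k]
  have hlim : Tendsto (fun k => (1 - ε) ^ k * ((⨆ i, x 0 i) - ⨅ i, x 0 i)) atTop (𝓝 0) := by
    simpa using (tendsto_pow_atTop_nhds_zero_of_lt_one (sub_nonneg.2 hε1)
      (sub_lt_self 1 hε)).mul_const ((⨆ i, x 0 i) - ⨅ i, x 0 i)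
  have hinf_lim := tendsto_atTop_ciSup hinf ⟨⨆ i, x 0 i, by
    rintro _ ⟨k, rfl⟩
    exact (hgap k).trans (hanti k.zero_le)⟩
  refine ⟨_, fun i => tendsto_of_tendsto_of_tendsto_of_le_of_le hinf_lim
    (by simpa using hinf_lim.add hlim) (fun k => hge k i) fun k => ?_⟩
  linarith [hle k i, hgeom k]

/-- Let `m ≥ 1`, `ε > 0`, and let `(Ω_k)` be a sequence of `m×m` row-stochastic
real matrices each of whose entries is at least `ε`.  Then the backward products
`P_k = Ω_{k-1}·…·Ω_1·Ω_0` converge entrywise to a matrix of the form `𝟙·vᵀ`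
(every row equal to `v`), where `v` is nonnegative with `∑ i, v i = 1`. -/
theorem backward_products_converge (m : ℕ) (hm : 1 ≤ m) (ε : ℝ) (hε : 0 < ε)
    (Ω : ℕ → Matrix (Fin m) (Fin m) ℝ)
    (hpos : ∀ k i j, ε ≤ Ω k i j)
    (hrow : ∀ k i, ∑ j, Ω k i j = 1)
    (P : ℕ → Matrix (Fin m) (Fin m) ℝ)
    (hP0 : P 0 = 1) (hPsucc : ∀ k, P (k + 1) = Ω k * P k) :
    ∃ v : Fin m → ℝ, (∀ i, 0 ≤ v i) ∧ (∑ i, v i = 1) ∧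
      ∀ i j, Tendsto (fun k => P k i j) atTop (𝓝 (v j)) := by
  have : Nonempty (Fin m) := ⟨⟨0, hm⟩⟩
  have hlim : ∀ j, ∃ c, ∀ i, Tendsto (fun k => P k i j) atTop (𝓝 c) := fun j =>
    exists_tendsto_of_averaging hε hpos hrow (x := fun k i => P k i j) fun k i => by
      rw [hPsucc, Matrix.mul_apply]
  choose v hv using hlim
  have hmem : ∀ k, P k ∈ Matrix.rowStochastic ℝ (Fin m) := by
    intro k
    induction k with
    | zero => exact hP0 ▸ one_mem _
    | succ k ih =>
      rw [hPsucc]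
      exact mul_mem (Matrix.mem_rowStochastic_iff_sum.2
        ⟨fun i j => hε.le.trans (hpos k i j), hrow k⟩) ih
  have hP := fun k => Matrix.mem_rowStochastic_iff_sum.1 (hmem k)
  let i₀ : Fin m := ⟨0, hm⟩
  refine ⟨v, fun j => ge_of_tendsto' (hv j i₀) fun k => (hP k).1 i₀ j, ?_, fun i j => hv j i⟩
  refine tendsto_nhds_unique (tendsto_finsetSum Finset.univ fun j _ => hv j i₀) ?_
  simp only [(hP _).2 i₀, tendsto_const_nhds]
end

section
/- Let m ≥ 1 and ε > 0, and let (Ω_k)_{k ∈ ℕ} be a sequence of m×m row-stochastic real matrices such that for every k: every diagonal entry of Ω_k is at least ε, every nonzero entry of Ω_k is at least ε, and the directed graph on {1,…,m} with an arc from j to i whenever (Ω_k)_{ij} > 0 is strongly connected. Then for every initial vector x(0) ∈ ℝ^m, the sequence defined by x(k+1) = Ω_k·x(k) achieves consensus: there exists x* ∈ ℝ such that every component of x(k) converges to x* as k → ∞. -/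
open Filter Topology

namespace StochasticConsensus

lemma exists_rel_of_transGen_of_mem_of_notMem {α : Type*} {r : α → α → Prop} {S : Set α} {a b : α}
    (h : Relation.TransGen r a b) (ha : a ∈ S) (hb : b ∉ S) :
    ∃ p q, p ∈ S ∧ q ∉ S ∧ r p q := by
  by_contra! H
  refine hb ?_
  clear hb
  induction h with
  | single hab => by_contra hc; exact H _ _ ha hc hab
  | tail _ hbc ih => by_contra hc; exact H _ _ ih hc hbc

lemma eq_univ_of_growing {ι : Type*} [Fintype ι] (S : ℕ → Finset ι) (h0 : (S 0).Nonempty)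
    (hmono : ∀ s, S s ⊆ S (s + 1)) (hgrow : ∀ s, S s ≠ Finset.univ → S s ≠ S (s + 1)) :
    S (Fintype.card ι) = Finset.univ := by
  have key : ∀ s, s < (S s).card ∨ S s = Finset.univ := by
    intro s
    induction s with
    | zero => exact Or.inl h0.card_pos
    | succ s ih =>
      by_cases hs : S s = Finset.univ
      · right
        exact Finset.univ_subset_iff.mp (hs ▸ hmono s)
      · left
        have h1 := ih.resolve_right hs
        have h2 := Finset.card_lt_card ((hmono s).ssubset_of_ne (hgrow s hs))
        lia
  exact (key _).resolve_left (Finset.card_le_univ _).not_gt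

variable {ι : Type*} [Fintype ι]

lemma mul_sub_le_mulVec_sub {A : Matrix ι ι ℝ} (hA : ∀ i j, 0 ≤ A i j)
    (hrow : ∀ i, ∑ j, A i j = 1) {y : ι → ℝ} {c : ℝ} (hc : ∀ j, c ≤ y j) (i j : ι) :
    A i j * (y j - c) ≤ A.mulVec y i - c := by
  have h : A.mulVec y i - c = ∑ j, A i j * (y j - c) := by
    simp only [mul_sub, Finset.sum_sub_distrib, ← Finset.sum_mul, hrow, one_mul,
      Matrix.mulVec, dotProduct]
  rw [h]
  exact Finset.single_le_sum (f := fun j => A i j * (y j - c))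
    (fun j _ => mul_nonneg (hA i j) (sub_nonneg.2 (hc j))) (Finset.mem_univ j)

lemma le_mulVec {A : Matrix ι ι ℝ} (hA : ∀ i j, 0 ≤ A i j)
    (hrow : ∀ i, ∑ j, A i j = 1) {y : ι → ℝ} {c : ℝ} (hc : ∀ j, c ≤ y j) (i : ι) :
    c ≤ A.mulVec y i := by
  have h := mul_sub_le_mulVec_sub hA hrow hc i i
  have := mul_nonneg (hA i i) (sub_nonneg.2 (hc i))
  linarith

lemma mulVec_le {A : Matrix ι ι ℝ} (hA : ∀ i j, 0 ≤ A i j)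
    (hrow : ∀ i, ∑ j, A i j = 1) {y : ι → ℝ} {c : ℝ} (hc : ∀ j, y j ≤ c) (i : ι) :
    A.mulVec y i ≤ c := by
  have h := le_mulVec hA hrow (y := -y) (c := -c) (fun j => neg_le_neg (hc j)) i
  rw [Matrix.mulVec_neg, Pi.neg_apply] at h
  exact neg_le_neg_iff.mp h

/-- After `card ι` steps every component exceeds a lower bound `c` of the initial vector by at
least `ε ^ card ι` times the initial excess of any given component. -/
lemma pow_mul_sub_le_iterate {ε : ℝ} (hε : 0 < ε) {Ω : ℕ → Matrix ι ι ℝ}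
    (hnonneg : ∀ k i j, 0 ≤ Ω k i j) (hrow : ∀ k i, ∑ j, Ω k i j = 1)
    (hdiag : ∀ k i, ε ≤ Ω k i i) (hentries : ∀ k i j, Ω k i j ≠ 0 → ε ≤ Ω k i j)
    (hconn : ∀ k, ∀ i j : ι, i ≠ j → Relation.TransGen (fun p q : ι => 0 < Ω k q p) i j)
    {x : ℕ → ι → ℝ} (hx : ∀ k, x (k + 1) = (Ω k).mulVec (x k)) {c : ℝ} (hc : ∀ j, c ≤ x 0 j)
    (i₀ i : ι) :
    ε ^ Fintype.card ι * (x 0 i₀ - c) ≤ x (Fintype.card ι) i - c := by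
  classical
  have hlow : ∀ s j, c ≤ x s j := by
    intro s
    induction s with
    | zero => exact hc
    | succ s ih => rw [hx]; exact le_mulVec (hnonneg s) (hrow s) ih
  let S : ℕ → Finset ι := fun s => {j | ε ^ s * (x 0 i₀ - c) ≤ x s j - c}
  have hS : ∀ s j, j ∈ S s ↔ ε ^ s * (x 0 i₀ - c) ≤ x s j - c := by simp [S]
  have step : ∀ s p q, p ∈ S s → ε ≤ Ω s q p → q ∈ S (s + 1) := by
    intro s p q hp hpq
    rw [hS] at hp ⊢
    have hp' := sub_nonneg.2 (hlow s p)
    calc ε ^ (s + 1) * (x 0 i₀ - c) = ε * (ε ^ s * (x 0 i₀ - c)) := by ring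
      _ ≤ ε * (x s p - c) := by gcongr
      _ ≤ Ω s q p * (x s p - c) := by gcongr
      _ ≤ x (s + 1) q - c := by
        rw [hx]; exact mul_sub_le_mulVec_sub (hnonneg s) (hrow s) (hlow s) q p
  have hmono : ∀ s, S s ⊆ S (s + 1) := fun s p hp => step s p p hp (hdiag s p)
  have h0 : i₀ ∈ S 0 := by simp [hS]
  have hi₀ : ∀ s, i₀ ∈ S s := by
    intro s
    induction s with
    | zero => exact h0
    | succ s ih => exact hmono s ih
  have huniv : S (Fintype.card ι) = Finset.univ := by
    refine eq_univ_of_growing S ⟨i₀, h0⟩ hmono fun s hs heq => ?_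
    obtain ⟨j, hj⟩ : ∃ j, j ∉ S s := by
      by_contra! h
      exact hs (Finset.eq_univ_iff_forall.2 h)
    have hne : i₀ ≠ j := fun h => hj (h ▸ hi₀ s)
    obtain ⟨p, q, hp, hq, hpq⟩ := exists_rel_of_transGen_of_mem_of_notMem (S := (S s : Set ι))
      (hconn s i₀ j hne) (hi₀ s) hj
    exact hq (heq ▸ step s p q hp (hentries s q p hpq.ne'))
  exact (hS _ i).1 (huniv ▸ Finset.mem_univ i)

theorem exists_tendsto [Nonempty ι] {ε : ℝ} (hε : 0 < ε) {Ω : ℕ → Matrix ι ι ℝ}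
    (hnonneg : ∀ k i j, 0 ≤ Ω k i j) (hrow : ∀ k i, ∑ j, Ω k i j = 1)
    (hdiag : ∀ k i, ε ≤ Ω k i i) (hentries : ∀ k i j, Ω k i j ≠ 0 → ε ≤ Ω k i j)
    (hconn : ∀ k, ∀ i j : ι, i ≠ j → Relation.TransGen (fun p q : ι => 0 < Ω k q p) i j)
    {x : ℕ → ι → ℝ} (hx : ∀ k, x (k + 1) = (Ω k).mulVec (x k)) :
    ∃ xs : ℝ, ∀ i, Tendsto (fun k => x k i) atTop (𝓝 xs) := by
  let u : ℕ → ℝ := fun k => ⨆ i, x k i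
  let l : ℕ → ℝ := fun k => ⨅ i, x k i
  have hu : ∀ k i, x k i ≤ u k := fun k i => le_ciSup (Finite.bddAbove_range (x k)) i
  have hl : ∀ k i, l k ≤ x k i := fun k i => ciInf_le (Finite.bddBelow_range (x k)) i
  have hlu : ∀ k, l k ≤ u k := fun k => (hl k (Classical.arbitrary ι)).trans (hu k _)
  have hu_anti : Antitone u := antitone_nat_of_succ_le fun k => ciSup_le fun i => by
    rw [hx]; exact mulVec_le (hnonneg k) (hrow k) (hu k) i
  have hl_mono : Monotone l := monotone_nat_of_le_succ fun k => le_ciInf fun i => by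
    rw [hx]; exact le_mulVec (hnonneg k) (hrow k) (hl k) i
  have hu_lim : Tendsto u atTop (𝓝 (⨅ k, u k)) :=
    tendsto_atTop_ciInf hu_anti
      ⟨l 0, by rintro _ ⟨k, rfl⟩; exact (hl_mono k.zero_le).trans (hlu k)⟩
  have hl_lim : Tendsto l atTop (𝓝 (⨆ k, l k)) :=
    tendsto_atTop_ciSup hl_mono
      ⟨u 0, by rintro _ ⟨k, rfl⟩; exact (hlu k).trans (hu_anti k.zero_le)⟩
  set a := ⨅ k, u k
  set b := ⨆ k, l k
  have hcontr : ∀ t, ε ^ Fintype.card ι * (u t - l t) ≤ l (t + Fintype.card ι) - l t := by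
    intro t
    obtain ⟨i₀, hi₀⟩ := exists_eq_ciSup_of_finite (f := x t)
    obtain ⟨i, hi⟩ := exists_eq_ciInf_of_finite (f := x (t + Fintype.card ι))
    have h := pow_mul_sub_le_iterate hε (Ω := fun k => Ω (t + k)) (fun k => hnonneg (t + k))
      (fun k => hrow (t + k)) (fun k => hdiag (t + k)) (fun k => hentries (t + k))
      (fun k => hconn (t + k)) (x := fun k => x (t + k)) (fun k => hx (t + k)) (hl t) i₀ i
    simp only [add_zero, hi₀, hi] at h
    exact h
  have hlim : ε ^ Fintype.card ι * (a - b) ≤ b - b :=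
    le_of_tendsto_of_tendsto' ((hu_lim.sub hl_lim).const_mul _)
      ((hl_lim.comp (tendsto_add_atTop_nat (Fintype.card ι))).sub hl_lim) hcontr
  have hba : b ≤ a := le_of_tendsto_of_tendsto' hl_lim hu_lim hlu
  have hab : a = b := by
    rw [sub_self] at hlim
    have := nonpos_of_mul_nonpos_right hlim (pow_pos hε (Fintype.card ι))
    linarith
  exact ⟨b, fun i => tendsto_of_tendsto_of_tendsto_of_le_of_le hl_lim (hab ▸ hu_lim)
    (fun k => hl k i) (fun k => hu k i)⟩

end StochasticConsensus

/-- Let `m ≥ 1`, `ε > 0`, and let `(Ω_k)` be a sequence of `m×m` row-stochastic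
real matrices such that for every `k`: every diagonal entry of `Ω_k` is at least
`ε`, every nonzero entry of `Ω_k` is at least `ε`, and the directed graph with
an arc from `j` to `i` whenever `(Ω_k)_{ij} > 0` is strongly connected.  Then
for every initial vector, the iteration `x(k+1) = Ω_k · x(k)` achieves
consensus: all components converge to a common limit `x*`. -/
theorem consensus_of_stochastic_iteration (m : ℕ) (hm : 1 ≤ m) (ε : ℝ) (hε : 0 < ε)
    (Ω : ℕ → Matrix (Fin m) (Fin m) ℝ)
    (hnonneg : ∀ k i j, 0 ≤ Ω k i j)
    (hrow : ∀ k i, ∑ j, Ω k i j = 1)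
    (hdiag : ∀ k i, ε ≤ Ω k i i)
    (hentries : ∀ k i j, Ω k i j ≠ 0 → ε ≤ Ω k i j)
    (hconn : ∀ k, ∀ i j : Fin m, i ≠ j →
      Relation.TransGen (fun p q : Fin m => 0 < Ω k q p) i j) :
    ∀ x : ℕ → Fin m → ℝ, (∀ k, x (k + 1) = (Ω k).mulVec (x k)) →
      ∃ xs : ℝ, ∀ i, Tendsto (fun k => x k i) atTop (𝓝 xs) := by
  intro x hx
  have : Nonempty (Fin m) := ⟨⟨0, hm⟩⟩
  exact StochasticConsensus.exists_tendsto hε hnonneg hrow hdiag hentries hconn hx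
end

section
/- (Main theorem, per-coordinate form.) Let n ≥ 2; let a_i, b_i > 0 for i = 1,…,n, let σ ∈ (0,1), and let d_i ∈ ℝ be desired displacements. Let 0 = t_0 < t_1 < t_2 < … be update times with Δ₁ ≤ t_{k+1} - t_k ≤ Δ₂ for fixed 0 < Δ₁ ≤ Δ₂. For each k let G(k) be a strongly connected directed graph on {1,…,n} and let h_{ij}(k) ≥ 0 be normalized fading coefficients with h_{ij}(k) > 0 iff (j,i) is an arc of G(k), Σ_{j=1}^n h_{ij}(k) = 1 for every i, and h_{ij}(k) ≥ ε whenever (j,i) is an arc of G(k), for a fixed ε > 0. Let x_i : [0,∞) → ℝ be continuous and ϑ_i : [0,∞) → ℝ satisfy: on each interval (t_k, t_{k+1}], x_i and ϑ_i are differentiable with ẋ_i(t) = -a_i·(x_i(t) - ϑ_i(t)) and ϑ̇_i(t) = b_i·(x_i(t) - ϑ_i(t)), where the value of ϑ_i just after t_k is reset to ϑ_i(t_k⁺) = (1-σ)·ϑ_i(t_k) + σ·d_i + σ·Σ_{j=1}^n h_{ij}(k)·(x_j(t_k) - d_j). Then there exists x* ∈ ℝ such that for every i, lim_{t→∞} x_i(t)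 = x* + d_i; i.e. the agents achieve the desired formation in this coordinate. -/
open Filter Topology

/-- A function with zero derivative on `(p, q]` takes there the value of its right limit at `p`. -/
lemma eq_rightLim_of_hasDerivWithinAt_zero {f : ℝ → ℝ} {p q l : ℝ}
    (hf : ∀ s ∈ Set.Ioc p q, HasDerivWithinAt f 0 (Set.Ioc p q) s)
    (hl : Tendsto f (𝓝[>] p) (𝓝 l)) {s : ℝ} (hs : s ∈ Set.Ioc p q) : f s = l := by
  have hconst : ∀ r ∈ Set.Ioc p q, f r = f s := by
    intro r hr
    have h := (convex_Ioc p q).norm_image_sub_le_of_norm_hasDerivWithin_le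
      (f' := fun _ => (0 : ℝ)) (C := 0) hf (by simp) hs hr
    rw [zero_mul] at h
    exact sub_eq_zero.mp (norm_le_zero_iff.mp h)
  have hev : ∀ᶠ r in 𝓝[>] p, f r = f s := by
    filter_upwards [Ioc_mem_nhdsGT (hs.1.trans_le hs.2)] with r hr using hconst r hr
  exact tendsto_nhds_unique (tendsto_const_nhds.congr' (hev.mono fun r hr => hr.symm)) hl

/-- Explicit solution of `ẋ = -a (x - y)`, `ẏ = b (x - y)` on `(p, q]`, given the right limits
of `x` and `y` at `p`. -/
lemma relaxation_solution {a b p q x₀ y₀ : ℝ} (ha : 0 < a) (hb : 0 < b) {x y : ℝ → ℝ}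
    (hode : ∀ s ∈ Set.Ioc p q,
      HasDerivWithinAt x (-a * (x s - y s)) (Set.Ioc p q) s ∧
      HasDerivWithinAt y (b * (x s - y s)) (Set.Ioc p q) s)
    (hx : Tendsto x (𝓝[>] p) (𝓝 x₀)) (hy : Tendsto y (𝓝[>] p) (𝓝 y₀))
    {s : ℝ} (hs : s ∈ Set.Ioc p q) :
    x s = x₀ - a / (a + b) * (1 - Real.exp (-((a + b) * (s - p)))) * (x₀ - y₀) ∧
    y s = y₀ + b / (a + b) * (1 - Real.exp (-((a + b) * (s - p)))) * (x₀ - y₀) := by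
  have hc : a + b ≠ 0 := by positivity
  have hV : b * x s + a * y s = b * x₀ + a * y₀ := by
    refine eq_rightLim_of_hasDerivWithinAt_zero (f := fun r => b * x r + a * y r) ?_
      ((hx.const_mul b).add (hy.const_mul a)) hs
    intro r hr
    refine (((hode r hr).1.const_mul b).add ((hode r hr).2.const_mul a)).congr_deriv ?_
    ring
  have hE : (x s - y s) * Real.exp ((a + b) * (s - p)) = x₀ - y₀ := by
    refine eq_rightLim_of_hasDerivWithinAt_zero
      (f := fun r => (x r - y r) * Real.exp ((a + b) * (r - p))) ?_ ?_ hs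
    · intro r hr
      have hexp : HasDerivWithinAt (fun r => Real.exp ((a + b) * (r - p)))
          (Real.exp ((a + b) * (r - p)) * ((a + b) * 1)) (Set.Ioc p q) r :=
        (((hasDerivAt_id r).sub_const p).const_mul (a + b)).exp.hasDerivWithinAt
      refine (((hode r hr).1.sub (hode r hr).2).mul hexp).congr_deriv ?_
      simp only [Pi.sub_apply]
      ring
    · have hexp : Tendsto (fun r => Real.exp ((a + b) * (r - p))) (𝓝[>] p) (𝓝 1) := by
        have : Continuous fun r => Real.exp ((a + b) * (r - p)) := by fun_prop
        simpa using (this.tendsto p).mono_left nhdsWithin_le_nhds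
      simpa using (hx.sub hy).mul hexp
  have hE' : x s - y s = (x₀ - y₀) * Real.exp (-((a + b) * (s - p))) := by
    rw [← hE, mul_assoc, ← Real.exp_add, add_neg_cancel, Real.exp_zero, mul_one]
  generalize Real.exp (-((a + b) * (s - p))) = E at hE' ⊢
  constructor
  · field_simp
    linear_combination hV + a * hE'
  · field_simp
    linear_combination hV - b * hE'

/-- The mixing weight `a / (a + b) * (1 - exp (-(a + b) τ))`, bounded away from `0` and `1`
uniformly over finitely many agents and over `τ ≥ Δ`. -/
lemma exists_uniform_mixing_bound {ι : Type*} [Finite ι] {a b : ι → ℝ}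
    (ha : ∀ i, 0 < a i) (hb : ∀ i, 0 < b i) {Δ : ℝ} (hΔ : 0 < Δ) :
    ∃ γ > 0, ∀ i, ∀ τ, Δ ≤ τ →
      γ ≤ a i / (a i + b i) * (1 - Real.exp (-((a i + b i) * τ))) ∧
      a i / (a i + b i) * (1 - Real.exp (-((a i + b i) * τ))) ≤ 1 - γ := by
  have key : ∀ i, ∃ γ > 0, ∀ τ, Δ ≤ τ →
      γ ≤ a i / (a i + b i) * (1 - Real.exp (-((a i + b i) * τ))) ∧
      a i / (a i + b i) * (1 - Real.exp (-((a i + b i) * τ))) ≤ 1 - γ := by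
    intro i
    have hai := ha i
    have hbi := hb i
    have hE : Real.exp (-((a i + b i) * Δ)) < 1 := by
      rw [Real.exp_lt_one_iff]
      have : 0 < (a i + b i) * Δ := by positivity
      linarith
    have hab : a i / (a i + b i) = 1 - b i / (a i + b i) := by
      field_simp
      ring
    refine ⟨min (a i / (a i + b i) * (1 - Real.exp (-((a i + b i) * Δ)))) (b i / (a i + b i)),
      lt_min (mul_pos (by positivity) (by linarith)) (by positivity), fun τ hτ => ⟨?_, ?_⟩⟩
    · refine (min_le_left _ _).trans ?_
      gcongr
    · have h1 := min_le_right (a i / (a i + b i) * (1 - Real.exp (-((a i + b i) * Δ))))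
        (b i / (a i + b i))
      have h2 : a i / (a i + b i) * (1 - Real.exp (-((a i + b i) * τ))) ≤ a i / (a i + b i) :=
        mul_le_of_le_one_right (by positivity) (by linarith [Real.exp_pos (-((a i + b i) * τ))])
      linarith
  choose γ hγ hγ' using key
  obtain ⟨g, hg, hg'⟩ : ∃ g > 0, ∀ i, g ≤ γ i := by
    rcases isEmpty_or_nonempty ι with hι | hι
    · exact ⟨1, one_pos, fun i => hι.elim i⟩
    · obtain ⟨i, hi⟩ := Finite.exists_min γ
      exact ⟨γ i, hγ i, hi⟩
  exact ⟨g, hg, fun i τ hτ =>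
    ⟨(hg' i).trans (hγ' i τ hτ).1, (hγ' i τ hτ).2.trans (by linarith [hg' i])⟩⟩

/-- Discrete-time consensus: an iteration that never leaves the range of its current values, gives
weight at least `δ` to every agent's own value, and across every cut has some agent giving weight
at least `δ` to a value on the other side, converges to a common value. -/
lemma tendsto_consensus {ι : Type*} [Fintype ι] [Nonempty ι] {δ : ℝ} (hδ : 0 < δ) (hδ1 : δ ≤ 1)
    (z : ℕ → ι → ℝ)
    (hlow : ∀ k L, (∀ j, L ≤ z k j) → ∀ i, L ≤ z (k + 1) i)
    (hself : ∀ k U, (∀ j, z k j ≤ U) → ∀ i, δ * (U - z k i) ≤ U - z (k + 1) i)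
    (hcut : ∀ k, ∀ S : Finset ι, S.Nonempty → S ≠ Finset.univ → ∃ j ∈ S, ∃ i ∉ S,
      ∀ U, (∀ l, z k l ≤ U) → δ * (U - z k j) ≤ U - z (k + 1) i) :
    ∃ c, ∀ i, Tendsto (fun k => z k i) atTop (𝓝 c) := by
  classical
  set N := Fintype.card ι
  have hup : ∀ k U, (∀ j, z k j ≤ U) → ∀ i, z (k + 1) i ≤ U := by
    intro k U hU i
    have := hself k U hU i
    have := mul_nonneg hδ.le (sub_nonneg.mpr (hU i))
    linarith
  have hupm : ∀ k U, (∀ j, z k j ≤ U) → ∀ s i, z (k + s) i ≤ U := by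
    intro k U hU s
    induction s with
    | zero => exact hU
    | succ s ih => exact hup _ U ih
  have hgrow : ∀ k U, (∀ j, z k j ≤ U) → ∀ i₀ s, ∃ S : Finset ι, S.Nonempty ∧
      (S = Finset.univ ∨ s < S.card) ∧ ∀ i ∈ S, δ ^ s * (U - z k i₀) ≤ U - z (k + s) i := by
    intro k U hU i₀ s
    induction s with
    | zero => exact ⟨{i₀}, by simp, by simp, by simp⟩
    | succ s ih =>
      obtain ⟨S, hS, hcard, hb⟩ := ih
      have hstep : ∀ j ∈ S, ∀ i, δ * (U - z (k + s) j) ≤ U - z (k + s + 1) i →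
          δ ^ (s + 1) * (U - z k i₀) ≤ U - z (k + s + 1) i := by
        intro j hj i hi
        have := mul_le_mul_of_nonneg_left (hb j hj) hδ.le
        rw [pow_succ]
        linarith
      by_cases hSu : S = Finset.univ
      · exact ⟨S, hS, Or.inl hSu, fun i hi => hstep i hi i (hself _ U (hupm k U hU s) i)⟩
      · obtain ⟨j, hj, i, hi, hji⟩ := hcut (k + s) S hS hSu
        refine ⟨insert i S, by simp, Or.inr ?_, fun l hl => ?_⟩
        · rw [Finset.card_insert_of_notMem hi]
          have := hcard.resolve_left hSu
          omega
        · rcases Finset.mem_insert.mp hl with rfl | hl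
          · exact hstep j hj l (hji U (hupm k U hU s))
          · exact hstep l hl l (hself _ U (hupm k U hU s) l)
  set M : ℕ → ℝ := fun k => Finset.univ.sup' Finset.univ_nonempty (z k)
  set m : ℕ → ℝ := fun k => Finset.univ.inf' Finset.univ_nonempty (z k)
  have hM : ∀ k j, z k j ≤ M k := fun k j => Finset.le_sup' (z k) (Finset.mem_univ j)
  have hm : ∀ k j, m k ≤ z k j := fun k j => Finset.inf'_le (z k) (Finset.mem_univ j)
  have hManti : Antitone M := antitone_nat_of_succ_le fun k =>
    Finset.sup'_le _ _ fun i _ => hup k _ (hM k) i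
  have hmmono : Monotone m := monotone_nat_of_le_succ fun k =>
    Finset.le_inf' _ _ fun i _ => hlow k _ (hm k) i
  have hmM : ∀ k, m k ≤ M k := fun k => (hm k (Classical.arbitrary ι)).trans (hM k _)
  have hcontr : ∀ k, M (k + N) - m (k + N) ≤ (1 - δ ^ N) * (M k - m k) := by
    intro k
    obtain ⟨i₀, -, hi₀⟩ := Finset.exists_mem_eq_inf' Finset.univ_nonempty (z k)
    obtain ⟨S, -, hcard, hb⟩ := hgrow k (M k) (hM k) i₀ N
    have hSu : S = Finset.univ := by
      rcases hcard with h | h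
      · exact h
      · exact absurd (Finset.card_le_univ S) (not_le.mpr h)
    have h1 : M (k + N) ≤ M k - δ ^ N * (M k - m k) := by
      refine Finset.sup'_le _ _ fun i _ => ?_
      have := hb i (hSu ▸ Finset.mem_univ i)
      rw [← hi₀] at this
      linarith
    have h2 : m k ≤ m (k + N) := hmmono (Nat.le_add_right k N)
    linarith
  have hpow : ∀ r, M (N * r) - m (N * r) ≤ (1 - δ ^ N) ^ r * (M 0 - m 0) := by
    intro r
    induction r with
    | zero => simp
    | succ r ih =>
      rw [Nat.mul_succ, pow_succ', mul_assoc]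
      exact (hcontr _).trans
        (mul_le_mul_of_nonneg_left ih (sub_nonneg.mpr (pow_le_one₀ hδ.le hδ1)))
  have hzero : Tendsto (fun r => (1 - δ ^ N) ^ r * (M 0 - m 0)) atTop (𝓝 0) := by
    simpa using (tendsto_pow_atTop_nhds_zero_of_lt_one
      (sub_nonneg.mpr (pow_le_one₀ hδ.le hδ1))
      (sub_lt_self 1 (pow_pos hδ N))).mul_const (M 0 - m 0)
  have hbdd : BddAbove (Set.range m) :=
    ⟨M 0, by rintro _ ⟨k, rfl⟩; exact (hmM k).trans (hManti (Nat.zero_le k))⟩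
  have hmlim : Tendsto m atTop (𝓝 (⨆ k, m k)) := tendsto_atTop_ciSup hmmono hbdd
  have hdiff : Tendsto (fun k => M k - m k) atTop (𝓝 0) := by
    rw [Metric.tendsto_atTop]
    intro η hη
    obtain ⟨r, hr⟩ := (hzero.eventually_lt_const hη).exists
    refine ⟨N * r, fun k hk => ?_⟩
    rw [Real.dist_eq, sub_zero, abs_of_nonneg (sub_nonneg.mpr (hmM k))]
    linarith [hManti hk, hmmono hk, hpow r]
  have hMlim : Tendsto M atTop (𝓝 (⨆ k, m k)) := by
    simpa using hmlim.add hdiff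
  exact ⟨_, fun i => tendsto_of_tendsto_of_tendsto_of_le_of_le hmlim hMlim
    (fun k => hm k i) (fun k => hM k i)⟩

/-- A path from `p` to its complement crosses the boundary along some arc. -/
lemma Relation.TransGen.exists_boundary {α : Type*} {r : α → α → Prop} {p : α → Prop} {u v : α}
    (h : Relation.TransGen r u v) (hu : p u) (hv : ¬ p v) : ∃ i j, r i j ∧ p i ∧ ¬ p j := by
  induction h with
  | single h => exact ⟨_, _, h, hu, hv⟩
  | @tail w v _ hwv ih =>
    by_cases hw : p w
    · exact ⟨_, _, hwv, hw, hv⟩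
    · exact ih hw

/-- Discrete-time consensus for pairs of states `(y, φ)`, where `φ` is first mixed with an average
of the `y`s over a strongly connected graph and the result is then mixed with `y`. -/
lemma tendsto_consensus_pair {ι : Type*} [Fintype ι] [Nonempty ι] {σ γ ε : ℝ}
    (hσ : σ ∈ Set.Ioo (0 : ℝ) 1) (hγ : 0 < γ) (hε : 0 < ε)
    {Adj : ℕ → ι → ι → Prop}
    (hconn : ∀ k, ∀ i j : ι, i ≠ j → Relation.TransGen (Adj k) i j)
    {h : ℕ → ι → ι → ℝ} (hh0 : ∀ k i j, 0 ≤ h k i j) (hh1 : ∀ k i, ∑ j, h k i j = 1)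
    (hhε : ∀ k i j, Adj k j i → ε ≤ h k i j)
    {α β : ℕ → ι → ℝ} (hα : ∀ k i, γ ≤ α k i ∧ α k i ≤ 1 - γ)
    (hβ : ∀ k i, γ ≤ β k i ∧ β k i ≤ 1 - γ)
    {y φ w : ℕ → ι → ℝ}
    (hw : ∀ k i, w k i = (1 - σ) * φ k i + σ * ∑ j, h k i j * y k j)
    (hy : ∀ k i, y (k + 1) i = (1 - α k i) * y k i + α k i * w k i)
    (hφ : ∀ k i, φ (k + 1) i = β k i * y k i + (1 - β k i) * w k i) :
    ∃ c, (∀ i, Tendsto (fun k => y k i) atTop (𝓝 c)) ∧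
      ∀ i, Tendsto (fun k => φ k i) atTop (𝓝 c) := by
  obtain ⟨hσ0, hσ1⟩ := hσ
  have hγ1 : γ < 1 := by
    have := hα 0 (Classical.arbitrary ι)
    linarith
  set κ := min (1 - σ) (σ * min ε 1)
  have hκ0 : 0 < κ := lt_min (by linarith) (mul_pos hσ0 (lt_min hε one_pos))
  have hκσ : κ ≤ 1 - σ := min_le_left _ _
  have hκε : κ ≤ σ * ε :=
    (min_le_right _ _).trans (mul_le_mul_of_nonneg_left (min_le_left _ _) hσ0.le)
  have hκ1 : κ < 1 := by linarith
  have hwU : ∀ k i U, U - w k i = (1 - σ) * (U - φ k i) + σ * ∑ j, h k i j * (U - y k j) := by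
    intro k i U
    simp only [mul_sub, Finset.sum_sub_distrib, ← Finset.sum_mul, hh1, hw]
    ring
  have hyU : ∀ k i U, U - y (k + 1) i = (1 - α k i) * (U - y k i) + α k i * (U - w k i) := by
    intro k i U
    rw [hy]
    ring
  have hφU : ∀ k i U, U - φ (k + 1) i = β k i * (U - y k i) + (1 - β k i) * (U - w k i) := by
    intro k i U
    rw [hφ]
    ring
  have hwlow : ∀ k i L, (∀ j, L ≤ y k j) → L ≤ φ k i → L ≤ w k i := by
    intro k i L hL hL'
    have hsum : ∑ j, h k i j * (L - y k j) ≤ 0 := Finset.sum_nonpos fun j _ =>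
      mul_nonpos_of_nonneg_of_nonpos (hh0 k i j) (by linarith [hL j])
    nlinarith [hwU k i L]
  have hwφ : ∀ k i U, (∀ j, y k j ≤ U) → φ k i ≤ U → κ * (U - φ k i) ≤ U - w k i := by
    intro k i U hU hU'
    have hsum : 0 ≤ ∑ j, h k i j * (U - y k j) := Finset.sum_nonneg fun j _ =>
      mul_nonneg (hh0 k i j) (by linarith [hU j])
    nlinarith [hwU k i U]
  have hwy : ∀ k i j U, Adj k j i → (∀ l, y k l ≤ U) → φ k i ≤ U →
      κ * (U - y k j) ≤ U - w k i := by
    intro k i j U hij hU hU'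
    have hsum : h k i j * (U - y k j) ≤ ∑ l, h k i l * (U - y k l) :=
      Finset.single_le_sum (f := fun l => h k i l * (U - y k l))
        (fun l _ => mul_nonneg (hh0 k i l) (by linarith [hU l])) (Finset.mem_univ j)
    have h1 : ε * (U - y k j) ≤ ∑ l, h k i l * (U - y k l) :=
      (mul_le_mul_of_nonneg_right (hhε k i j hij) (by linarith [hU j])).trans hsum
    have h2 : κ * (U - y k j) ≤ σ * ε * (U - y k j) :=
      mul_le_mul_of_nonneg_right hκε (by linarith [hU j])
    have h3 := mul_le_mul_of_nonneg_left h1 hσ0.le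
    have h4 : 0 ≤ (1 - σ) * (U - φ k i) := mul_nonneg (by linarith) (by linarith)
    rw [hwU]
    linarith
  have hwup : ∀ k i U, (∀ j, y k j ≤ U) → φ k i ≤ U → 0 ≤ U - w k i := fun k i U hU hU' =>
    (mul_nonneg hκ0.le (by linarith)).trans (hwφ k i U hU hU')
  have hmix : ∀ {c v D : ℝ}, γ ≤ c → 0 ≤ v → κ * D ≤ v → γ * κ * D ≤ c * v := by
    intro c v D hc hv hD
    have h1 := mul_le_mul_of_nonneg_left hD hγ.le
    have h2 := mul_le_mul_of_nonneg_right hc hv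
    linarith
  have hshrink : ∀ {D : ℝ}, 0 ≤ D → κ * D ≤ D := fun hD => mul_le_of_le_one_left hD hκ1.le
  suffices hlim : ∃ c, ∀ i, Tendsto (fun k => Sum.elim (y k) (φ k) i) atTop (𝓝 c) by
    obtain ⟨c, hc⟩ := hlim
    exact ⟨c, fun i => hc (Sum.inl i), fun i => hc (Sum.inr i)⟩
  refine tendsto_consensus (ι := ι ⊕ ι) (δ := γ * κ) (mul_pos hγ hκ0)
    (mul_le_one₀ hγ1.le hκ0.le hκ1.le) (fun k => Sum.elim (y k) (φ k)) ?_ ?_ ?_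
  · intro k L hL
    have hLy : ∀ j, L ≤ y k j := fun j => hL (Sum.inl j)
    have hLφ : ∀ j, L ≤ φ k j := fun j => hL (Sum.inr j)
    rintro (i | i) <;> simp only [Sum.elim_inl, Sum.elim_inr]
    · have := hwlow k i L hLy (hLφ i)
      nlinarith [hyU k i L, hα k i, hLy i]
    · have := hwlow k i L hLy (hLφ i)
      nlinarith [hφU k i L, hβ k i, hLy i]
  · intro k U hU
    have hUy : ∀ j, y k j ≤ U := fun j => hU (Sum.inl j)
    have hUφ : ∀ j, φ k j ≤ U := fun j => hU (Sum.inr j)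
    rintro (i | i) <;> simp only [Sum.elim_inl, Sum.elim_inr]
    · have hD : 0 ≤ U - y k i := by linarith [hUy i]
      have h1 := hmix (c := 1 - α k i) (by linarith [hα k i]) hD (hshrink hD)
      have h2 := mul_nonneg (hγ.le.trans (hα k i).1) (hwup k i U hUy (hUφ i))
      rw [hyU]
      linarith
    · have hD : 0 ≤ U - y k i := by linarith [hUy i]
      have h1 := hmix (c := 1 - β k i) (by linarith [hβ k i]) (hwup k i U hUy (hUφ i))
        (hwφ k i U hUy (hUφ i))
      have h2 := mul_nonneg (hγ.le.trans (hβ k i).1) hD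
      rw [hφU]
      linarith
  · intro k S hS hSu
    by_cases hsplit : ∀ i, Sum.inl i ∈ S ↔ Sum.inr i ∈ S
    · obtain ⟨u, hu⟩ : ∃ u, Sum.inl u ∈ S := by
        obtain ⟨u | u, hu⟩ := hS
        exacts [⟨u, hu⟩, ⟨u, (hsplit u).mpr hu⟩]
      obtain ⟨v, hv⟩ : ∃ v, Sum.inl v ∉ S := by
        by_contra! hall
        exact hSu (Finset.eq_univ_iff_forall.mpr
          (Sum.rec hall fun i => (hsplit i).mp (hall i)))
      have huv : u ≠ v := by
        rintro rfl
        exact hv hu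
      obtain ⟨j, i, hji, hj, hi⟩ :=
        (hconn k u v huv).exists_boundary (p := fun i => Sum.inl i ∈ S) hu hv
      refine ⟨_, hj, _, hi, fun U hU => ?_⟩
      have hUy : ∀ j, y k j ≤ U := fun j => hU (Sum.inl j)
      have hUφ : ∀ j, φ k j ≤ U := fun j => hU (Sum.inr j)
      simp only [Sum.elim_inl]
      have h1 := hmix (hα k i).1 (hwup k i U hUy (hUφ i)) (hwy k i j U hji hUy (hUφ i))
      have h2 : 0 ≤ (1 - α k i) * (U - y k i) :=
        mul_nonneg (by linarith [hα k i]) (by linarith [hUy i])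
      rw [hyU]
      linarith
    · push Not at hsplit
      obtain ⟨i, ⟨hi, hi'⟩ | ⟨hi', hi⟩⟩ := hsplit
      · refine ⟨_, hi, _, hi', fun U hU => ?_⟩
        have hUy : ∀ j, y k j ≤ U := fun j => hU (Sum.inl j)
        have hUφ : ∀ j, φ k j ≤ U := fun j => hU (Sum.inr j)
        simp only [Sum.elim_inl, Sum.elim_inr]
        have hD : 0 ≤ U - y k i := by linarith [hUy i]
        have h1 := hmix (hβ k i).1 hD (hshrink hD)
        have h2 : 0 ≤ (1 - β k i) * (U - w k i) :=
          mul_nonneg (by linarith [hβ k i]) (hwup k i U hUy (hUφ i))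
        rw [hφU]
        linarith
      · refine ⟨_, hi, _, hi', fun U hU => ?_⟩
        have hUy : ∀ j, y k j ≤ U := fun j => hU (Sum.inl j)
        have hUφ : ∀ j, φ k j ≤ U := fun j => hU (Sum.inr j)
        simp only [Sum.elim_inl, Sum.elim_inr]
        have h1 := hmix (hα k i).1 (hwup k i U hUy (hUφ i)) (hwφ k i U hUy (hUφ i))
        have h2 : 0 ≤ (1 - α k i) * (U - y k i) :=
          mul_nonneg (by linarith [hα k i]) (by linarith [hUy i])
        rw [hyU]
        linarith

/-- A sequence with increments bounded below starting at `0` partitions `(0, ∞)` into the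
intervals `(t k, t (k + 1)]`. -/
lemma exists_mem_Ioc_of_add_le_succ {t : ℕ → ℝ} {Δ : ℝ} (hΔ : 0 < Δ)
    (ht : ∀ k, Δ ≤ t (k + 1) - t k) {K : ℕ} {s : ℝ} (hs : t K < s) :
    ∃ k ≥ K, s ∈ Set.Ioc (t k) (t (k + 1)) := by
  classical
  have hgrow : ∀ k, t 0 + k * Δ ≤ t k := by
    intro k
    induction k with
    | zero => simp
    | succ k ih =>
      push_cast
      linarith [ht k]
  have hmono : Monotone t := monotone_nat_of_le_succ fun k => by linarith [ht k]
  have hex : ∃ k, s ≤ t k := by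
    obtain ⟨k, hk⟩ := exists_nat_gt ((s - t 0) / Δ)
    rw [div_lt_iff₀ hΔ] at hk
    exact ⟨k, by linarith [hgrow k]⟩
  have hlt : K < Nat.find hex := by
    by_contra! hle
    exact absurd ((Nat.find_spec hex).trans (hmono hle)) (not_le.mpr hs)
  obtain ⟨k, hk⟩ : ∃ k, Nat.find hex = k + 1 := ⟨Nat.find hex - 1, by omega⟩
  refine ⟨k, by omega, not_le.mp (Nat.find_min hex (by omega)), hk ▸ Nat.find_spec hex⟩

/-- **Main theorem (per-coordinate form).**
Agents `i ∈ {1,…,n}` (`n ≥ 2`) with positions `x i` (continuous on `[0,∞)`) and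
auxiliary controller states `ϑ i` evolve between synchronized update times
`0 = t 0 < t 1 < …` (with `Δ₁ ≤ t (k+1) - t k ≤ Δ₂`, `0 < Δ₁ ≤ Δ₂`) according
to `ẋ_i = -a_i (x_i - ϑ_i)`, `ϑ̇_i = b_i (x_i - ϑ_i)` on each `(t k, t (k+1)]`,
while at each update time `ϑ_i` is reset (as a right limit) to
`(1-σ)·ϑ_i(t_k) + σ·d_i + σ·∑_j h_{ij}(k)·(x_j(t_k) - d_j)`.
The normalized fading coefficients `h k i j` are nonnegative, positive exactly
on the arcs of a strongly connected communication graph `Adj k` (arc `(j,i)`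
meaning `Adj k j i`), bounded below by `ε > 0` on arcs, and row-stochastic.
Then there exists `x* ∈ ℝ` with `lim_{t→∞} x_i(t) = x* + d_i` for every `i`:
the agents achieve the desired formation in this coordinate. -/
theorem formation_control_convergence
    (n : ℕ) (hn : 2 ≤ n)
    (a b : Fin n → ℝ) (ha : ∀ i, 0 < a i) (hb : ∀ i, 0 < b i)
    (σ : ℝ) (hσ : σ ∈ Set.Ioo (0 : ℝ) 1)
    (d : Fin n → ℝ)
    (t : ℕ → ℝ) (ht0 : t 0 = 0)
    (Δ₁ Δ₂ : ℝ) (hΔ₁ : 0 < Δ₁) (hΔ₁₂ : Δ₁ ≤ Δ₂)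
    (htk : ∀ k, Δ₁ ≤ t (k + 1) - t k ∧ t (k + 1) - t k ≤ Δ₂)
    (Adj : ℕ → Fin n → Fin n → Prop)
    (hconn : ∀ k, ∀ i j : Fin n, i ≠ j → Relation.TransGen (Adj k) i j)
    (h : ℕ → Fin n → Fin n → ℝ)
    (hh0 : ∀ k i j, 0 ≤ h k i j)
    (hharc : ∀ k i j, 0 < h k i j ↔ Adj k j i)
    (hh1 : ∀ k i, ∑ j, h k i j = 1)
    (ε : ℝ) (hε : 0 < ε)
    (hhε : ∀ k i j, Adj k j i → ε ≤ h k i j)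
    (x ϑ : Fin n → ℝ → ℝ)
    (hxcont : ∀ i, ContinuousOn (x i) (Set.Ici (0 : ℝ)))
    (hode : ∀ i, ∀ k, ∀ s ∈ Set.Ioc (t k) (t (k + 1)),
      HasDerivWithinAt (x i) (-(a i) * (x i s - ϑ i s)) (Set.Ioc (t k) (t (k + 1))) s ∧
      HasDerivWithinAt (ϑ i) (b i * (x i s - ϑ i s)) (Set.Ioc (t k) (t (k + 1))) s)
    (hreset : ∀ i, ∀ k, Tendsto (ϑ i) (𝓝[>] (t k))
      (𝓝 ((1 - σ) * ϑ i (t k) + σ * d i + σ * ∑ j, h k i j * (x j (t k) - d j)))) :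
    ∃ xs : ℝ, ∀ i, Tendsto (fun s => x i s) atTop (𝓝 (xs + d i)) := by
  have : Nonempty (Fin n) := ⟨⟨0, by omega⟩⟩
  have htmono : Monotone t := monotone_nat_of_le_succ fun k => by linarith [htk k]
  have htnn : ∀ k, 0 ≤ t k := fun k => ht0 ▸ htmono (Nat.zero_le k)
  set ψ : ℕ → Fin n → ℝ := fun k i =>
    (1 - σ) * ϑ i (t k) + σ * d i + σ * ∑ j, h k i j * (x j (t k) - d j) with hψ
  have hsol := fun i k s (hs : s ∈ Set.Ioc (t k) (t (k + 1))) =>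
    relaxation_solution (ha i) (hb i) (hode i k)
      (((hxcont i) (t k) (htnn k)).mono (fun r hr => (htnn k).trans (le_of_lt hr)))
      (hreset i k) hs
  obtain ⟨γ₁, hγ₁, hα⟩ := exists_uniform_mixing_bound ha hb hΔ₁
  obtain ⟨γ₂, hγ₂, hβ⟩ := exists_uniform_mixing_bound hb ha hΔ₁
  set A : Fin n → ℝ → ℝ := fun i τ => a i / (a i + b i) * (1 - Real.exp (-((a i + b i) * τ)))
    with hA
  set B : Fin n → ℝ → ℝ := fun i τ => b i / (a i + b i) * (1 - Real.exp (-((a i + b i) * τ)))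
    with hB
  have hend : ∀ k, t (k + 1) ∈ Set.Ioc (t k) (t (k + 1)) := fun k =>
    ⟨by linarith [htk k], le_rfl⟩
  obtain ⟨c, hyc, hφc⟩ := tendsto_consensus_pair (γ := min γ₁ γ₂) hσ (lt_min hγ₁ hγ₂) hε hconn
    hh0 hh1 hhε (α := fun k i => A i (t (k + 1) - t k)) (β := fun k i => B i (t (k + 1) - t k))
    (y := fun k i => x i (t k) - d i) (φ := fun k i => ϑ i (t k) - d i)
    (w := fun k i => ψ k i - d i)
    (fun k i => by
      have := hα i _ (htk k).1
      have := min_le_left γ₁ γ₂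
      constructor <;> linarith)
    (fun k i => by
      have := hβ i _ (htk k).1
      rw [add_comm (b i)] at this
      have := min_le_right γ₁ γ₂
      constructor <;> linarith)
    (fun k i => by simp only [hψ]; ring)
    (fun k i => by
      have := (hsol i k _ (hend k)).1
      simp only [hA, hψ]
      linear_combination this)
    (fun k i => by
      have := (hsol i k _ (hend k)).2
      simp only [hB, hψ]
      linear_combination this)
  have hψc : ∀ i, Tendsto (fun k => ψ k i) atTop (𝓝 (c + d i)) := by
    intro i
    have hsum : Tendsto (fun k => ∑ j, h k i j * (x j (t k) - d j - c)) atTop (𝓝 0) := by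
      rw [← Finset.sum_const_zero (s := (Finset.univ : Finset (Fin n)))]
      refine tendsto_finsetSum _ fun j _ => ?_
      have hj : Tendsto (fun k => x j (t k) - d j - c) atTop (𝓝 0) := by
        simpa using (hyc j).sub_const c
      refine squeeze_zero_norm (fun k => ?_) (by simpa using hj.norm)
      have hle : h k i j ≤ 1 := hh1 k i ▸
        Finset.single_le_sum (fun l _ => hh0 k i l) (Finset.mem_univ j)
      rw [norm_mul, Real.norm_of_nonneg (hh0 k i j)]
      exact mul_le_of_le_one_left (norm_nonneg _) hle
    have hlim := (((hφc i).const_mul (1 - σ)).add (hsum.const_mul σ)).add_const (σ * c + d i)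
    have hval : (1 - σ) * c + σ * 0 + (σ * c + d i) = c + d i := by ring
    rw [hval] at hlim
    refine hlim.congr fun k => ?_
    have hsplit : ∑ j, h k i j * (x j (t k) - d j - c)
        = ∑ j, h k i j * (x j (t k) - d j) - c := by
      simp only [mul_sub _ _ c, Finset.sum_sub_distrib, ← Finset.sum_mul, hh1, one_mul]
    rw [hsplit, hψ]
    ring
  refine ⟨c, fun i => ?_⟩
  have hxc : Tendsto (fun k => x i (t k)) atTop (𝓝 (c + d i)) := by
    simpa using (hyc i).add_const (d i)
  rw [Metric.tendsto_atTop]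
  intro η hη
  obtain ⟨K, hK⟩ := eventually_atTop.mp
    ((hxc.eventually (Metric.ball_mem_nhds _ hη)).and
      ((hψc i).eventually (Metric.ball_mem_nhds _ hη)))
  refine ⟨t K + 1, fun s hs => ?_⟩
  obtain ⟨k, hkK, hks⟩ := exists_mem_Ioc_of_add_le_succ hΔ₁ (fun k => (htk k).1)
    (show t K < s by linarith)
  have hA0 : 0 ≤ A i (s - t k) ∧ A i (s - t k) ≤ 1 := by
    have hab : 0 < a i + b i := add_pos (ha i) (hb i)
    have hexp : Real.exp (-((a i + b i) * (s - t k))) ≤ 1 :=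
      Real.exp_le_one_iff.mpr (neg_nonpos.mpr (mul_nonneg hab.le (by linarith [hks.1])))
    have hfrac : a i / (a i + b i) ≤ 1 := (div_le_one hab).mpr (by linarith [hb i])
    exact ⟨mul_nonneg (div_nonneg (ha i).le hab.le) (by linarith),
      mul_le_one₀ hfrac (by linarith) (by linarith [Real.exp_pos (-((a i + b i) * (s - t k)))])⟩
  have hseg := (convex_ball (c + d i) η) (hK k hkK).1 (hK k hkK).2
    (sub_nonneg.mpr hA0.2) hA0.1 (sub_add_cancel _ _)
  rw [Metric.mem_ball] at hseg
  convert hseg using 2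
  have := (hsol i k s hks).1
  simp only [smul_eq_mul, hA, hψ]
  linear_combination this
end
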